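/- For every integer n ≥ 1, ∑_{k=1}^∞ ((ζ(2k) − 1)/n^{2k−1})·F_{2k−1} = (1/√5)·π·sin(√5·π/n)/(cos(√5·π/n) − cos(π/n)) + 2n(n⁴ − 5n² + 3)/((2n² − 3 + √5)(2n² − 3 − √5)). -/

import Mathlib

open Real

def lucas : ℕ → ℕ
  | 0 => 2
  | 1 => 1
  | n + 2 => lucas n + lucas (n + 1)

def fibZ (n : ℤ) : ℤ :=
  if 0 ≤ n then (Nat.fib n.toNat : ℤ) else (-1) ^ (n.natAbs + 1) * (Nat.fib n.natAbs : ℤ)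

def lucasZ (n : ℤ) : ℤ :=
  if 0 ≤ n then (lucas n.toNat : ℤ) else (-1) ^ n.natAbs * (lucas n.natAbs : ℤ)

lemma hasSum_odd_pow_div_even_pow {𝕜 : Type*} [NormedField 𝕜] {r M : 𝕜} (h : ‖r‖ < ‖M‖) :
    HasSum (fun k : ℕ ↦ r ^ (2 * k + 1) / M ^ (2 * k + 2)) (r / (M ^ 2 - r ^ 2)) := by
  have hM : M ≠ 0 := norm_pos_iff.mp ((norm_nonneg r).trans_lt h)
  have hq : ‖r ^ 2 / M ^ 2‖ < 1 := by
    rw [norm_div, norm_pow, norm_pow, div_lt_one (by positivity)]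
    gcongr
  have hne : M ^ 2 - r ^ 2 ≠ 0 := by
    intro h0
    rw [← sub_eq_zero.mp h0, div_self (pow_ne_zero 2 hM), norm_one] at hq
    exact lt_irrefl _ hq
  convert (hasSum_geometric_of_norm_lt_one hq).mul_left (r / M ^ 2) using 1
  · rfl
  · ext k
    rw [← div_pow, ← pow_mul, div_pow, pow_succ, pow_add M]
    field_simp
  · rw [one_sub_div (pow_ne_zero 2 hM), inv_div]
    field_simp

lemma hasSum_one_div_add_two_pow_even (k : ℕ) :
    HasSum (fun m : ℕ ↦ 1 / ((m : ℂ) + 2) ^ (2 * k + 2)) (riemannZeta (2 * (k + 1)) - 1) := by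
  have hk : 1 < 2 * k + 2 := by omega
  have hz : HasSum (fun m : ℕ ↦ 1 / (m : ℂ) ^ (2 * k + 2)) (riemannZeta (2 * (k + 1))) := by
    have hs : Summable (fun m : ℕ ↦ 1 / (m : ℂ) ^ (2 * k + 2)) := by
      have h := Complex.ofRealCLM.summable (Real.summable_one_div_nat_pow.mpr hk)
      simpa using h
    have he : (2 * ((k : ℂ) + 1)) = ((2 * k + 2 : ℕ) : ℂ) := by push_cast; ring
    rw [he, zeta_nat_eq_tsum_of_gt_one hk]
    exact hs.hasSum
  convert (hasSum_nat_add_iff' 2).mpr hz using 1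
  · rfl
  · ext m
    push_cast
    rfl
  · simp [Finset.sum_range_succ]

lemma summable_odd_pow_div_even_pow {z : ℂ} (hz : ‖z‖ < 2) :
    Summable (fun p : ℕ × ℕ ↦ z ^ (2 * p.2 + 1) / ((p.1 : ℂ) + 2) ^ (2 * p.2 + 2)) := by
  have hnorm (m : ℕ) : ‖(m : ℂ) + 2‖ = m + 2 := by
    exact_mod_cast Complex.norm_natCast (m + 2)
  have hlt (m : ℕ) : ‖‖z‖‖ < ‖(m : ℝ) + 2‖ := by
    rw [norm_norm, Real.norm_of_nonneg (by positivity)]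
    linarith [(Nat.cast_nonneg m : (0 : ℝ) ≤ m)]
  refine Summable.of_norm ?_
  simp only [norm_div, norm_pow, hnorm]
  refine (summable_prod_of_nonneg fun _ ↦ by positivity).mpr
    ⟨fun m ↦ (hasSum_odd_pow_div_even_pow (hlt m)).summable, ?_⟩
  simp only [fun m : ℕ ↦ (hasSum_odd_pow_div_even_pow (hlt m)).tsum_eq]
  have hsq : Summable (fun m : ℕ ↦ 1 / ((m : ℝ) + 2) ^ 2) := by
    simpa using (summable_nat_add_iff 2).mpr (Real.summable_one_div_nat_pow.mpr one_lt_two)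
  have hc : 0 < 1 - ‖z‖ ^ 2 / 4 := by nlinarith [norm_nonneg z]
  refine (hsq.mul_left (‖z‖ / (1 - ‖z‖ ^ 2 / 4))).of_nonneg_of_le (fun m ↦ ?_) fun m ↦ ?_
  · have : ‖z‖ ^ 2 ≤ ((m : ℝ) + 2) ^ 2 := by
      gcongr
      linarith [(Nat.cast_nonneg m : (0 : ℝ) ≤ m)]
    exact div_nonneg (norm_nonneg z) (sub_nonneg.mpr this)
  · rw [div_mul_div_comm, mul_one]
    refine div_le_div_of_nonneg_left (norm_nonneg z) (by positivity) ?_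
    nlinarith [mul_nonneg (sq_nonneg ‖z‖)
      (by positivity : (0 : ℝ) ≤ (m : ℝ) ^ 2 + 4 * m)]

lemma hasSum_div_add_two_sq_sub_sq {z : ℂ} (hz : z ∈ Complex.integerComplement) :
    HasSum (fun m : ℕ ↦ z / (((m : ℂ) + 2) ^ 2 - z ^ 2))
      ((1 / z - π * Complex.cot (π * z)) / 2 - z / (1 - z ^ 2)) := by
  have hcot : HasSum (fun m : ℕ ↦ cotTerm z m) (π * Complex.cot (π * z) - 1 / z) := by
    rw [cot_series_rep' hz]
    exact (summable_cotTerm hz).hasSum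
  have hterm (m : ℕ) : -(1 / 2) * cotTerm z m = z / (((m : ℂ) + 1) ^ 2 - z ^ 2) := by
    have h : ((m : ℂ) + 1) ^ 2 - z ^ 2 ≠ 0 := by
      have := Complex.integerComplement_pow_two_ne_pow_two hz (m + 1)
      push_cast at this
      exact sub_ne_zero.mpr this.symm
    have h' : (z + (m + 1)) * (z - (m + 1)) ≠ 0 := by
      intro h0
      exact h (by linear_combination -h0)
    rw [cotTerm_identity hz, ← mul_assoc, mul_one_div, div_eq_div_iff h' h]
    ring
  convert (hasSum_nat_add_iff' 1).mpr (hcot.mul_left (-(1 / 2))) using 1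
  · rfl
  · ext m
    rw [hterm]
    push_cast
    ring
  · rw [Finset.sum_range_one, hterm]
    push_cast
    ring

lemma hasSum_riemannZeta_even_sub_one_mul_pow {z : ℂ} (hz : z ∈ Complex.integerComplement)
    (hz2 : ‖z‖ < 2) :
    HasSum (fun k : ℕ ↦ (riemannZeta (2 * (k + 1)) - 1) * z ^ (2 * k + 1))
      ((1 / z - π * Complex.cot (π * z)) / 2 - z / (1 - z ^ 2)) := by
  have hS := (summable_odd_pow_div_even_pow hz2).hasSum
  have hrow (m : ℕ) : HasSum (fun k : ℕ ↦ z ^ (2 * k + 1) / ((m : ℂ) + 2) ^ (2 * k + 2))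
      (z / (((m : ℂ) + 2) ^ 2 - z ^ 2)) := by
    refine hasSum_odd_pow_div_even_pow ?_
    have : ‖(m : ℂ) + 2‖ = m + 2 := by exact_mod_cast Complex.norm_natCast (m + 2)
    linarith [(Nat.cast_nonneg m : (0 : ℝ) ≤ m)]
  have hS' : HasSum (fun m : ℕ ↦ z / (((m : ℂ) + 2) ^ 2 - z ^ 2)) _ :=
    hS.prod_fiberwise hrow
  rw [hS'.unique (hasSum_div_add_two_sq_sub_sq hz)] at hS
  have hswap : HasSum
      (fun p : ℕ × ℕ ↦ z ^ (2 * p.1 + 1) / ((p.2 : ℂ) + 2) ^ (2 * p.1 + 2)) _ :=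
    (Equiv.prodComm ℕ ℕ).hasSum_iff.mpr hS
  refine hswap.prod_fiberwise fun k ↦ ?_
  simpa only [one_div_mul_eq_div] using
    (hasSum_one_div_add_two_pow_even k).mul_right (z ^ (2 * k + 1))

lemma Irrational.ofReal_mem_integerComplement {x : ℝ} (hx : Irrational x) :
    (x : ℂ) ∈ Complex.integerComplement := by
  rintro ⟨m, hm⟩
  exact hx.ne_int m (by exact_mod_cast hm.symm)

lemma cot_sub_cot_eq_sin_div_cos_sub_cos {a b : ℝ} (ha : sin a ≠ 0) (hb : sin b ≠ 0) :
    cot b - cot a = 2 * sin (a - b) / (cos (a - b) - cos (a + b)) := by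
  have h : cos (a - b) - cos (a + b) = 2 * (sin a * sin b) := by
    rw [cos_sub, cos_add]
    ring
  rw [h, cot_eq_cos_div_sin, cot_eq_cos_div_sin, sin_sub]
  field_simp

lemma Irrational.sin_pi_mul_ne_zero {x : ℝ} (hx : Irrational x) : sin (π * x) ≠ 0 := by
  intro h
  obtain ⟨m, hm⟩ := sin_eq_zero_iff.mp h
  exact hx.ne_int m (mul_left_cancel₀ pi_ne_zero (by rw [← hm, mul_comm]))

lemma Irrational.one_sub_sq_ne_zero {x : ℝ} (hx : Irrational x) : 1 - x ^ 2 ≠ 0 := by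
  intro h
  rcases sq_eq_one_iff.mp (sub_eq_zero.mp h).symm with h | h
  · exact hx.ne_one h
  · exact hx.ne_int (-1) (by exact_mod_cast h)

theorem stmt5 (n : ℕ) (hn : 1 ≤ n) :
    ∑' k : ℕ, (riemannZeta (2 * (k + 1)) - 1) / (n : ℂ) ^ (2 * k + 1) * (Nat.fib (2 * k + 1) : ℂ) =
      ((1 / Real.sqrt 5 * (π * Real.sin (Real.sqrt 5 * π / n) /
          (Real.cos (Real.sqrt 5 * π / n) - Real.cos (π / n)))
        + 2 * n * ((n : ℝ) ^ 4 - 5 * n ^ 2 + 3) /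
          ((2 * (n : ℝ) ^ 2 - 3 + Real.sqrt 5) * (2 * (n : ℝ) ^ 2 - 3 - Real.sqrt 5)) : ℝ) : ℂ) := by
  have hn0 : (n : ℝ) ≠ 0 := by positivity
  have hn1 : (1 : ℝ) ≤ n := by exact_mod_cast hn
  obtain ⟨x, hx⟩ : ∃ x : ℝ, x = goldenRatio / n := ⟨_, rfl⟩
  obtain ⟨y, hy⟩ : ∃ y : ℝ, y = goldenConj / n := ⟨_, rfl⟩
  have hxi : Irrational x := hx ▸ goldenRatio_irrational.div_natCast (by omega)
  have hyi : Irrational y := hy ▸ goldenConj_irrational.div_natCast (by omega)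
  have hx2 : ‖(x : ℂ)‖ < 2 := by
    rw [hx, Complex.norm_real, Real.norm_of_nonneg (div_nonneg goldenRatio_pos.le (by positivity)),
      div_lt_iff₀ (by positivity)]
    linarith [goldenRatio_lt_two]
  have hy2 : ‖(y : ℂ)‖ < 2 := by
    rw [hy, Complex.norm_real, Real.norm_eq_abs, abs_lt, lt_div_iff₀ (by positivity),
      div_lt_iff₀ (by positivity)]
    constructor <;> linarith [goldenConj_neg, neg_one_lt_goldenConj]
  have hsum := ((hasSum_riemannZeta_even_sub_one_mul_pow hxi.ofReal_mem_integerComplement hx2).sub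
    (hasSum_riemannZeta_even_sub_one_mul_pow hyi.ofReal_mem_integerComplement hy2)).mul_right
      ((1 / √5 : ℝ) : ℂ)
  have hterm (k : ℕ) : (riemannZeta (2 * (k + 1)) - 1) / (n : ℂ) ^ (2 * k + 1) *
      (Nat.fib (2 * k + 1) : ℂ) =
      ((riemannZeta (2 * (k + 1)) - 1) * (x : ℂ) ^ (2 * k + 1) -
        (riemannZeta (2 * (k + 1)) - 1) * (y : ℂ) ^ (2 * k + 1)) * ((1 / √5 : ℝ) : ℂ) := by
    rw [← Complex.ofReal_natCast (Nat.fib _), coe_fib_eq, hx, hy]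
    generalize goldenRatio = a, goldenConj = b
    push_cast
    rw [div_pow, div_pow]
    ring
  rw [tsum_congr hterm, hsum.tsum_eq, ← Complex.ofReal_mul π x, ← Complex.ofReal_mul π y,
    ← Complex.ofReal_cot, ← Complex.ofReal_cot]
  rw [show ((1 / (x : ℂ) - π * (cot (π * x) : ℝ)) / 2 - x / (1 - x ^ 2) -
      ((1 / (y : ℂ) - π * (cot (π * y) : ℝ)) / 2 - y / (1 - y ^ 2))) * ((1 / √5 : ℝ) : ℂ) =
      (((1 / x - π * cot (π * x)) / 2 - x / (1 - x ^ 2) -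
        ((1 / y - π * cot (π * y)) / 2 - y / (1 - y ^ 2))) * (1 / √5) : ℝ) by push_cast; rfl,
    Complex.ofReal_inj]
  have hs5 : √5 ^ 2 = 5 := Real.sq_sqrt (by norm_num)
  have hs0 : √5 ≠ 0 := by positivity
  have hsub : x - y = √5 / n := by rw [hx, hy, ← sub_div, goldenRatio_sub_goldenConj]
  have hadd : x + y = 1 / n := by rw [hx, hy, ← add_div, goldenRatio_add_goldenConj]
  have hmul : x * y = -1 / n ^ 2 := by
    rw [hx, hy, div_mul_div_comm, goldenRatio_mul_goldenConj, sq]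
  have hcot := cot_sub_cot_eq_sin_div_cos_sub_cos hxi.sin_pi_mul_ne_zero hyi.sin_pi_mul_ne_zero
  rw [← mul_sub, ← mul_add, hsub, hadd, mul_div_assoc', mul_div_assoc', mul_one,
    mul_comm π √5] at hcot
  have hx1 := hxi.one_sub_sq_ne_zero
  have hy1 := hyi.one_sub_sq_ne_zero
  have hinv : 1 / x - 1 / y = √5 * n := by
    rw [div_sub_div _ _ hxi.ne_zero hyi.ne_zero, hmul, one_mul, mul_one, ← neg_sub, hsub]
    field_simp
  have hprod : (1 - x ^ 2) * (1 - y ^ 2) = (n ^ 4 - 3 * n ^ 2 + 1) / n ^ 4 := by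
    have : (1 - x ^ 2) * (1 - y ^ 2) = 1 - (x + y) ^ 2 + 2 * (x * y) + (x * y) ^ 2 := by ring
    rw [this, hadd, hmul]
    field_simp
    ring
  have hden : (n : ℝ) ^ 4 - 3 * n ^ 2 + 1 ≠ 0 := by
    intro h
    rw [h, zero_div] at hprod
    exact mul_ne_zero hx1 hy1 hprod
  have hrat : x / (1 - x ^ 2) - y / (1 - y ^ 2) =
      √5 * (n * (n ^ 2 - 1) / (n ^ 4 - 3 * n ^ 2 + 1)) := by
    have : x * (1 - y ^ 2) - (1 - x ^ 2) * y = (x - y) * (1 + x * y) := by ring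
    rw [div_sub_div _ _ hx1 hy1, hprod, this, hsub, hmul]
    field_simp
    ring
  have hden' : (2 * (n : ℝ) ^ 2 - 3 + √5) * (2 * (n : ℝ) ^ 2 - 3 - √5) =
      4 * (n ^ 4 - 3 * n ^ 2 + 1) := by linear_combination -hs5
  rw [hden']
  have hmain : (1 / x - π * cot (π * x)) / 2 - x / (1 - x ^ 2) -
      ((1 / y - π * cot (π * y)) / 2 - y / (1 - y ^ 2)) =
      π / 2 * (cot (π * y) - cot (π * x)) + √5 * n / 2 -
        √5 * (n * (n ^ 2 - 1) / (n ^ 4 - 3 * n ^ 2 + 1)) := by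
    rw [← hinv, ← hrat]
    ring
  have hfin : (n : ℝ) / 2 - n * (n ^ 2 - 1) / (n ^ 4 - 3 * n ^ 2 + 1) =
      2 * n * (n ^ 4 - 5 * n ^ 2 + 3) / (4 * (n ^ 4 - 3 * n ^ 2 + 1)) := by
    rw [div_sub_div _ _ two_ne_zero hden, div_eq_div_iff (by positivity) (by positivity)]
    ring
  rw [hmain, hcot, ← hfin]
  field_simp
  ring
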